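/- Let π ∈ S_NC(p,q) be a non-crossing annular permutation. Define a partition π̄ of {1,…,p} whose blocks are the cycles of π contained in {1,…,p}, together with one block consisting of all remaining points of {1,…,p} (those lying on through cycles). Then π̄ is a non-crossing partition of {1,…,p}. -/

import Mathlib

open Equiv Finset
open scoped Classical

noncomputable section

def numCycles {n : ℕ} (π : Equiv.Perm (Fin n)) : ℕ :=
  π.cycleType.card + (univ.filter fun x => π x = x).card

def plen {n : ℕ} (π : Equiv.Perm (Fin n)) : ℕ := n - numCycles π

def gammaPQ (p q : ℕ) : Equiv.Perm (Fin (p + q)) :=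
  finSumFinEquiv.permCongr (Equiv.sumCongr (finRotate p) (finRotate q))

def cycleLen {n : ℕ} (π : Equiv.Perm (Fin n)) (k : Fin n) : ℕ :=
  (univ.filter fun m => π.SameCycle k m).card

def Separates {n : ℕ} (σ : Equiv.Perm (Fin n)) (A : Finset (Fin n)) : Prop :=
  ∀ a ∈ A, ∀ b ∈ A, σ.SameCycle a b → a = b

def oddSet (n : ℕ) : Finset (Fin n) := univ.filter fun i => Odd (i.val + 1)

def IsSNC (p q : ℕ) (π : Equiv.Perm (Fin (p + q))) : Prop :=
  (∃ i j, π.SameCycle i j ∧ ¬ (gammaPQ p q).SameCycle i j) ∧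
    numCycles π + numCycles (gammaPQ p q * π⁻¹) = p + q

def SameParity {n : ℕ} (a b : Fin n) : Prop := (Odd (a.val + 1) ↔ Odd (b.val + 1))

def EvenCycles {n : ℕ} (π : Equiv.Perm (Fin n)) : Prop := ∀ k, Even (cycleLen π k)

def ParityReversing {n : ℕ} (π : Equiv.Perm (Fin n)) : Prop := ∀ k, ¬ SameParity k (π k)

def SNCminus (p q : ℕ) (π : Equiv.Perm (Fin (p + q))) : Prop :=
  IsSNC p q π ∧ EvenCycles π ∧ ParityReversing π

end

/-- The block relation of the partition π̄ of the first circle: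
cycles of π contained in {1,…,p} are blocks, all remaining points of the
first circle form one block. -/
def barRel (p q : ℕ) (π : Equiv.Perm (Fin (p + q))) (i j : Fin (p + q)) : Prop :=
  ((∀ m, π.SameCycle i m → m.val < p) ∧ π.SameCycle i j) ∨
    ((¬ ∀ m, π.SameCycle i m → m.val < p) ∧ (¬ ∀ m, π.SameCycle j m → m.val < p))

theorem Equiv.Perm.SameCycle.mem_of_mapsTo {α : Type*} [Finite α] {σ : Equiv.Perm α} {S : Set α}
    (hS : ∀ z ∈ S, σ z ∈ S) {x y : α} (h : σ.SameCycle x y) (hx : x ∈ S) : y ∈ S := by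
  obtain ⟨m, -, rfl⟩ := h.exists_pow_eq'
  clear h
  induction m with
  | zero => simpa using hx
  | succ m ih => rw [pow_succ', Equiv.Perm.mul_apply]; exact hS _ ih

theorem Equiv.Perm.SameCycle.of_eqOn {α : Type*} [Finite α] {σ ρ : Equiv.Perm α} {x y : α}
    (h : σ.SameCycle x y) (hρ : ∀ z, σ.SameCycle x z → ρ z = σ z) : ρ.SameCycle x y := by
  have := h.mem_of_mapsTo (S := {z | σ.SameCycle x z ∧ ρ.SameCycle x z})
    (fun z hz => ⟨Equiv.Perm.sameCycle_apply_right.2 hz.1,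
      hρ z hz.1 ▸ Equiv.Perm.sameCycle_apply_right.2 hz.2⟩) ⟨.refl _ _, .refl _ _⟩
  exact this.2

theorem Equiv.Perm.SameCycle.mul_swap {α : Type*} [Finite α] [DecidableEq α] {σ : Equiv.Perm α}
    {x y a b : α} (h : σ.SameCycle x y) (ha : ¬ σ.SameCycle x a) (hb : ¬ σ.SameCycle x b) :
    (σ * Equiv.swap a b).SameCycle x y := by
  refine h.of_eqOn fun z hz => ?_
  rw [Equiv.Perm.mul_apply, Equiv.swap_apply_of_ne_of_ne]
  · rintro rfl; exact ha hz
  · rintro rfl; exact hb hz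

/-- Multiplying by a transposition merges two distinct cycles. -/
theorem Equiv.Perm.sameCycle_mul_swap {α : Type*} [Finite α] [DecidableEq α]
    {σ : Equiv.Perm α} {a b : α} (h : ¬ σ.SameCycle a b) :
    (σ * Equiv.swap a b).SameCycle a b := by
  set ρ := σ * Equiv.swap a b with hρ
  by_contra hn
  have hρσ : ∀ z, z ≠ a → z ≠ b → ρ z = σ z := fun z h1 h2 => by
    rw [hρ, Equiv.Perm.mul_apply, Equiv.swap_apply_of_ne_of_ne h1 h2]
  have hρb : ρ b = σ a := by simp [hρ]
  have key : σ⁻¹.SameCycle a (σ a) := by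
    simpa using Equiv.Perm.SameCycle.refl σ a
  have := key.mem_of_mapsTo (S := {z | σ.SameCycle a z ∧ ρ.SameCycle a z}) (fun y hy => by
    have h1 : σ.SameCycle a (σ⁻¹ y) := by
      rw [← Equiv.Perm.sameCycle_apply_right]
      simpa using hy.1
    refine ⟨h1, ?_⟩
    have hb : σ⁻¹ y ≠ b := fun e => h (e ▸ h1)
    by_cases ha : σ⁻¹ y = a
    · exact ha ▸ .refl _ _
    · rw [← Equiv.Perm.sameCycle_apply_right, hρσ _ ha hb]
      simpa using hy.2) ⟨.refl _ _, .refl _ _⟩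
  exact hn (by rw [← Equiv.Perm.sameCycle_apply_right, hρb]; exact this.2)

theorem numCycles_eq_card_quotient {n : ℕ} (σ : Equiv.Perm (Fin n)) :
    numCycles σ = Nat.card (Quotient (Equiv.Perm.SameCycle.setoid σ)) := by
  let g : Fin n → Equiv.Perm (Fin n) ⊕ Fin n := fun x =>
    if σ x = x then .inr x else .inl (σ.cycleOf x)
  have hker : Equiv.Perm.SameCycle.setoid σ = Setoid.ker g := by
    ext x y
    change σ.SameCycle x y ↔ g x = g y
    by_cases hx : σ x = x
    · have hxy : σ.SameCycle x y ↔ x = y :=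
        ⟨fun h => h.eq_of_left hx, fun h => h ▸ .refl _ _⟩
      rw [hxy]
      by_cases hy : σ y = y
      · simp [g, hx, hy]
      · simp only [g, hx, hy, if_true, if_false, reduceCtorEq, iff_false]
        rintro rfl; exact hy hx
    · by_cases hy : σ y = y
      · simp only [g, hx, hy, if_true, if_false, reduceCtorEq, iff_false]
        intro h
        exact hx ((h.symm.eq_of_left hy) ▸ hy)
      · simp only [g, hx, hy, if_false, Sum.inl.injEq]
        exact Equiv.Perm.sameCycle_iff_cycleOf_eq_of_mem_support
          (Equiv.Perm.mem_support.2 hx) (Equiv.Perm.mem_support.2 hy)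
  have hrange : Set.range g =
      ((σ.cycleFactorsFinset.disjSum (univ.filter fun x => σ x = x) :
        Finset (Equiv.Perm (Fin n) ⊕ Fin n)) : Set (Equiv.Perm (Fin n) ⊕ Fin n)) := by
    ext (c | x)
    · simp only [Set.mem_range, Finset.mem_coe, Finset.inl_mem_disjSum]
      constructor
      · rintro ⟨x, hx⟩
        by_cases h : σ x = x
        · simp [g, h] at hx
        · simp only [g, h, if_false, Sum.inl.injEq] at hx
          rw [← hx, Equiv.Perm.cycleOf_mem_cycleFactorsFinset_iff]
          exact Equiv.Perm.mem_support.2 h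
      · intro hc
        obtain ⟨x, hx⟩ := (Equiv.Perm.mem_cycleFactorsFinset_iff.1 hc).1.nonempty_support
        refine ⟨x, ?_⟩
        have h : σ x ≠ x :=
          Equiv.Perm.mem_support.1 (Equiv.Perm.mem_cycleFactorsFinset_support_le hc hx)
        simp only [g, h, if_false, Sum.inl.injEq]
        exact (Equiv.Perm.cycle_is_cycleOf hx hc).symm
    · simp only [Set.mem_range, Finset.mem_coe, Finset.inr_mem_disjSum, mem_filter, mem_univ,
        true_and]
      constructor
      · rintro ⟨y, hy⟩
        by_cases h : σ y = y
        · simp only [g, h, if_true, Sum.inr.injEq] at hy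
          exact hy ▸ h
        · simp [g, h] at hy
      · exact fun h => ⟨x, by simp [g, h]⟩
  rw [hker, Nat.card_congr (Setoid.quotientKerEquivRange g), hrange]
  simp [numCycles, Equiv.Perm.cycleType_def]

/-- The space of functions fixed by a permutation. -/
def fixedFunctions {n : ℕ} (σ : Equiv.Perm (Fin n)) : Submodule ℚ (Fin n → ℚ) where
  carrier := {f | ∀ x, f (σ x) = f x}
  add_mem' := fun hf hg x => by simp [hf x, hg x]
  zero_mem' := fun _ => rfl
  smul_mem' := fun c f hf x => by simp [hf x]

theorem eq_of_mem_fixedFunctions {n : ℕ} {σ : Equiv.Perm (Fin n)} {f : Fin n → ℚ}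
    (hf : f ∈ fixedFunctions σ) {x y : Fin n} (h : σ.SameCycle x y) : f y = f x :=
  h.mem_of_mapsTo (S := {z | f z = f x}) (fun z hz => (hf z).trans hz) rfl

theorem finrank_fixedFunctions {n : ℕ} (σ : Equiv.Perm (Fin n)) :
    Module.finrank ℚ (fixedFunctions σ) = numCycles σ := by
  let e : (Quotient (Equiv.Perm.SameCycle.setoid σ) → ℚ) ≃ₗ[ℚ] fixedFunctions σ :=
    { toFun := fun g => ⟨fun x => g ⟦x⟧, fun x =>
        congrArg g (Quotient.sound (s := Equiv.Perm.SameCycle.setoid σ)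
          (Equiv.Perm.sameCycle_apply_left.2 (.refl _ _)))⟩
      invFun := fun f => Quotient.lift f.1 fun _ _ h => (eq_of_mem_fixedFunctions f.2 h).symm
      map_add' := fun _ _ => rfl
      map_smul' := fun _ _ => rfl
      left_inv := fun g => by ext x; induction x using Quotient.inductionOn; rfl
      right_inv := fun f => rfl }
  rw [← e.finrank_eq, Module.finrank_fintype_fun_eq_card, numCycles_eq_card_quotient,
    Nat.card_eq_fintype_card]

theorem numCycles_add_le {n : ℕ} (σ τ : Equiv.Perm (Fin n)) :
    numCycles σ + numCycles τ ≤ n + numCycles (σ * τ) := by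
  simp only [← finrank_fixedFunctions]
  rw [← Submodule.finrank_sup_add_finrank_inf_eq]
  refine add_le_add ?_ (Submodule.finrank_mono ?_)
  · simpa using Submodule.finrank_le (fixedFunctions σ ⊔ fixedFunctions τ)
  · rintro f ⟨h1, h2⟩ x
    exact (h1 _).trans (h2 x)

theorem card_fixed_add_sum_cycleType {n : ℕ} (σ : Equiv.Perm (Fin n)) :
    (univ.filter fun x => σ x = x).card + σ.cycleType.sum = n := by
  rw [Equiv.Perm.sum_cycleType, Equiv.Perm.support,
    Finset.card_filter_add_card_filter_not, Finset.card_univ, Fintype.card_fin]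

theorem sign_eq_neg_one_pow_numCycles {n : ℕ} (σ : Equiv.Perm (Fin n)) :
    Equiv.Perm.sign σ = (-1) ^ (n + numCycles σ) := by
  have h1 := card_fixed_add_sum_cycleType σ
  have h2 : n + numCycles σ = σ.cycleType.sum + σ.cycleType.card +
      2 * (univ.filter fun x => σ x = x).card := by
    rw [numCycles]; omega
  rw [Equiv.Perm.sign_of_cycleType, h2, pow_add _ _ (2 * _), pow_mul]
  simp

theorem numCycles_mul_swap_of_sameCycle {n : ℕ} {σ : Equiv.Perm (Fin n)} {a b : Fin n}
    (hab : a ≠ b) (h : σ.SameCycle a b) : numCycles σ + 1 ≤ numCycles (σ * Equiv.swap a b) := by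
  have hle : numCycles σ ≤ numCycles (σ * Equiv.swap a b) := by
    simp only [← finrank_fixedFunctions]
    refine Submodule.finrank_mono fun f hf x => ?_
    rw [Equiv.Perm.mul_apply, hf]
    have := eq_of_mem_fixedFunctions hf h
    rw [Equiv.swap_apply_def]
    split_ifs with h1 h2
    · rw [h1, this]
    · rw [h2, this]
    · rfl
  refine Nat.lt_of_le_of_ne hle fun e => ?_
  have h1 := sign_eq_neg_one_pow_numCycles σ
  have h2 := sign_eq_neg_one_pow_numCycles (σ * Equiv.swap a b)
  rw [← e, ← h1, Equiv.Perm.sign_mul, Equiv.Perm.sign_swap hab] at h2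
  rcases Int.units_eq_one_or (Equiv.Perm.sign σ) with h3 | h3 <;> rw [h3] at h2 <;>
    exact absurd h2 (by decide)

theorem numCycles_mul_swap_of_not_sameCycle {n : ℕ} {σ : Equiv.Perm (Fin n)} {a b : Fin n}
    (h : ¬ σ.SameCycle a b) : numCycles (σ * Equiv.swap a b) + 1 ≤ numCycles σ := by
  have hab : a ≠ b := by rintro rfl; exact h (.refl _ _)
  simpa [mul_assoc] using
    numCycles_mul_swap_of_sameCycle hab (Equiv.Perm.sameCycle_mul_swap h)

theorem numCycles_swap {n : ℕ} {a b : Fin n} (hab : a ≠ b) :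
    numCycles (Equiv.swap a b) + 1 = n := by
  have h := card_fixed_add_sum_cycleType (Equiv.swap a b)
  have hc : (Equiv.swap a b).cycleType = {2} := by
    rw [(Equiv.Perm.isCycle_swap hab).cycleType, Equiv.Perm.card_support_swap hab]
  rw [hc, Multiset.sum_singleton] at h
  rw [numCycles, hc, Multiset.card_singleton]
  omega

theorem numCycles_mul_swap_le {n : ℕ} (σ : Equiv.Perm (Fin n)) (a b : Fin n) :
    numCycles (σ * Equiv.swap a b) ≤ numCycles σ + 1 := by
  by_cases hab : a = b
  · subst hab
    rw [Equiv.swap_self, ← Equiv.Perm.one_def, mul_one]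
    exact Nat.le_succ _
  · have h1 := numCycles_add_le (σ * Equiv.swap a b) (Equiv.swap a b)
    have h2 := numCycles_swap hab
    rw [mul_assoc, Equiv.swap_mul_self, mul_one] at h1
    omega

theorem numCycles_le_card {n : ℕ} {β : Type*} [Finite β] (σ : Equiv.Perm (Fin n))
    (g : Fin n → β) (hg : ∀ x y, g x = g y → σ.SameCycle x y) : numCycles σ ≤ Nat.card β := by
  rw [numCycles_eq_card_quotient]
  refine Nat.card_le_card_of_injective (fun c => g c.out) fun c d h => ?_
  rw [← c.out_eq, ← d.out_eq]
  exact Quotient.sound (s := Equiv.Perm.SameCycle.setoid σ) (hg _ _ h)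

/-- If `#π + #(γ π⁻¹) = n` and `γ` has at most two cycles, then no three transpositions can
successively split cycles of `π` while the last two of them merge cycles of `γ`. -/
theorem false_of_split_of_merge {n : ℕ} {π γ : Equiv.Perm (Fin n)}
    (hγ : numCycles γ ≤ 2) (hπ : numCycles π + numCycles (γ * π⁻¹) = n)
    {u v x y a b : Fin n} (huv : u ≠ v) (h1 : π.SameCycle u v)
    (h2 : (π * Equiv.swap u v).SameCycle x y)
    (h3 : (π * Equiv.swap u v * Equiv.swap x y).SameCycle a b)
    (h4 : ¬ (γ * Equiv.swap u v).SameCycle x y)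
    (h5 : ¬ (γ * Equiv.swap u v * Equiv.swap x y).SameCycle a b) : False := by
  have hxy : x ≠ y := by rintro rfl; exact h4 (.refl _ _)
  have hab : a ≠ b := by rintro rfl; exact h5 (.refl _ _)
  have e1 := numCycles_mul_swap_of_sameCycle huv h1
  have e2 := numCycles_mul_swap_of_sameCycle hxy h2
  have e3 := numCycles_mul_swap_of_sameCycle hab h3
  have e4 := numCycles_mul_swap_le γ u v
  have e5 := numCycles_mul_swap_of_not_sameCycle h4
  have e6 := numCycles_mul_swap_of_not_sameCycle h5
  have e7 := numCycles_add_le (γ * π⁻¹)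
    (π * Equiv.swap u v * Equiv.swap x y * Equiv.swap a b)
  simp only [mul_assoc, inv_mul_cancel_left] at *
  omega

theorem gammaPQ_val_of_lt {p q : ℕ} {x : Fin (p + q)} (hx : x.val < p) :
    (gammaPQ p q x).val = if x.val + 1 < p then x.val + 1 else 0 := by
  obtain ⟨p, rfl⟩ : ∃ p', p = p' + 1 := ⟨p - 1, by omega⟩
  obtain ⟨z, rfl⟩ : ∃ z : Fin (p + 1), x = Fin.castAdd q z := ⟨⟨x, hx⟩, rfl⟩
  simp only [gammaPQ, Equiv.permCongr_apply, finSumFinEquiv_symm_apply_castAdd,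
    Equiv.sumCongr_apply, Sum.map_inl, finSumFinEquiv_apply_left, Fin.val_castAdd, coe_finRotate]
  have := z.isLt
  simp only [Fin.ext_iff, Fin.val_last]
  split_ifs <;> omega

theorem gammaPQ_val_of_ge {p q : ℕ} {x : Fin (p + q)} (hx : p ≤ x.val) :
    (gammaPQ p q x).val = if x.val + 1 < p + q then x.val + 1 else p := by
  obtain ⟨q, rfl⟩ : ∃ q', q = q' + 1 := ⟨q - 1, by have := x.isLt; omega⟩
  obtain ⟨z, rfl⟩ : ∃ z : Fin (q + 1), x = Fin.natAdd p z :=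
    ⟨⟨x - p, by have := x.isLt; omega⟩, by ext; simp; omega⟩
  simp only [gammaPQ, Equiv.permCongr_apply, finSumFinEquiv_symm_apply_natAdd,
    Equiv.sumCongr_apply, Sum.map_inr, finSumFinEquiv_apply_right, Fin.val_natAdd, coe_finRotate]
  have := z.isLt
  simp only [Fin.ext_iff, Fin.val_last]
  split_ifs <;> omega

theorem gammaPQ_sameCycle {p q : ℕ} {x y : Fin (p + q)} (h : x.val < p ↔ y.val < p) :
    (gammaPQ p q).SameCycle x y := by
  wlog hxy : x.val ≤ y.val generalizing x y
  · exact (this h.symm (by omega)).symm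
  obtain ⟨d, hd⟩ := Nat.exists_eq_add_of_le hxy
  induction d generalizing y with
  | zero => exact (Fin.ext hd : y = x) ▸ .refl _ _
  | succ d ih =>
    have hy := y.isLt
    have hz := @ih ⟨x + d, by omega⟩ (by simp only; omega) (by simp) rfl
    have e : gammaPQ p q ⟨x + d, by omega⟩ = y := by
      ext
      by_cases hp : y.val < p
      · rw [gammaPQ_val_of_lt (by simp only; omega)]
        simp only
        split_ifs <;> omega
      · rw [gammaPQ_val_of_ge (by simp only; omega)]
        simp only
        split_ifs <;> omega
    exact e ▸ Equiv.Perm.sameCycle_apply_right.2 hz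

theorem numCycles_gammaPQ_le (p q : ℕ) : numCycles (gammaPQ p q) ≤ 2 := by
  simpa using numCycles_le_card (gammaPQ p q) (fun x => decide (x.val < p))
    fun x y h => gammaPQ_sameCycle (by simpa using h)

theorem gammaPQ_lt {p q : ℕ} {x : Fin (p + q)} (hx : x.val < p) : (gammaPQ p q x).val < p := by
  rw [gammaPQ_val_of_lt hx]
  split_ifs <;> omega

/-- The interval `(u, v]` is invariant under `γ * swap u v`. -/
theorem gammaPQ_mul_swap_mem_Ioc {p q : ℕ} {u v : Fin (p + q)} (huv : u.val < v.val)
    (hv : v.val < p) : ∀ z ∈ Set.Ioc u v, (gammaPQ p q * Equiv.swap u v) z ∈ Set.Ioc u v := by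
  rintro z ⟨h1, h2⟩
  rw [Fin.lt_def] at h1
  rw [Fin.le_def] at h2
  rw [Set.mem_Ioc, Fin.lt_def, Fin.le_def, Equiv.Perm.mul_apply]
  by_cases hz : z = v
  · rw [hz, Equiv.swap_apply_right, gammaPQ_val_of_lt (by omega)]
    split_ifs <;> omega
  · rw [Equiv.swap_apply_of_ne_of_ne (by rintro rfl; omega) hz, gammaPQ_val_of_lt (by omega)]
    have : z.val ≠ v.val := fun e => hz (Fin.ext e)
    split_ifs <;> omega

theorem swap_apply_mem {α : Type*} [DecidableEq α] {S : Set α} {a b : α} (h : a ∈ S ↔ b ∈ S)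
    {z : α} (hz : z ∈ S) : Equiv.swap a b z ∈ S := by
  rw [Equiv.swap_apply_def]
  split_ifs with h1 h2
  · exact h.1 (h1 ▸ hz)
  · exact h.2 (h2 ▸ hz)
  · exact hz

section

variable {p q : ℕ} {π : Equiv.Perm (Fin (p + q))}

theorem IsSNC.exists_through (hπ : IsSNC p q π) :
    ∃ a b, π.SameCycle a b ∧ a.val < p ∧ p ≤ b.val := by
  obtain ⟨⟨a, b, hab, hn⟩, -⟩ := hπ
  have : ¬ (a.val < p ↔ b.val < p) := fun h => hn (gammaPQ_sameCycle h)
  by_cases ha : a.val < p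
  · exact ⟨a, b, hab, ha, by simp_all⟩
  · exact ⟨b, a, hab.symm, by simp_all, by omega⟩

/-- Two cycles contained in the first circle do not cross. -/
theorem IsSNC.false_of_inner_of_inner (hπ : IsSNC p q π) {u v x y : Fin (p + q)}
    (huv : u.val < v.val) (hv : v.val < p) (hy : y ∈ Set.Ioc u v) (hx : x ∉ Set.Ioc u v)
    (h1 : π.SameCycle u v) (hui : ∀ m, π.SameCycle u m → m.val < p)
    (h2 : π.SameCycle y x) (hyi : ∀ m, π.SameCycle y m → m.val < p)
    (huy : ¬ π.SameCycle u y) : False := by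
  obtain ⟨a, b, hab, ha, hb⟩ := hπ.exists_through
  have ha' : ∀ w, π.SameCycle u w ∨ π.SameCycle y w → ¬ π.SameCycle a w := by
    rintro w (h | h) haw
    · exact absurd (hui b (h.trans (haw.symm.trans hab))) (by omega)
    · exact absurd (hyi b (h.trans (haw.symm.trans hab))) (by omega)
  refine false_of_split_of_merge (numCycles_gammaPQ_le p q) hπ.2 (u := u) (v := v) (x := y)
    (y := x) (a := a) (b := b) (by rintro rfl; omega) h1 ?_ ?_ ?_ ?_
  · exact h2.mul_swap (fun h => huy h.symm) fun h => huy (h1.trans h.symm)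
  · refine hab.of_eqOn fun z hz => ?_
    have hne : ∀ w, π.SameCycle u w ∨ π.SameCycle y w → z ≠ w := fun w hw e =>
      ha' w hw (e ▸ hz)
    simp only [Equiv.Perm.mul_apply]
    rw [Equiv.swap_apply_of_ne_of_ne (hne y (.inr (.refl _ _))) (hne x (.inr h2)),
      Equiv.swap_apply_of_ne_of_ne (hne u (.inl (.refl _ _))) (hne v (.inl h1))]
  · exact fun h => hx (h.mem_of_mapsTo (gammaPQ_mul_swap_mem_Ioc huv hv) hy)
  · intro h
    have : b.val < p := h.mem_of_mapsTo (S := {z : Fin (p + q) | z.val < p})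
      (fun z hz => gammaPQ_lt (x := Equiv.swap u v (Equiv.swap y x z))
        (swap_apply_mem (S := {z : Fin (p + q) | z.val < p}) (iff_of_true (huv.trans hv) hv)
          (swap_apply_mem (S := {z : Fin (p + q) | z.val < p})
            (iff_of_true (hyi y (.refl _ _)) (hyi x h2)) hz))) ha
    omega

/-- A cycle contained in the first circle does not separate points of through cycles. -/
theorem IsSNC.false_of_inner_of_through (hπ : IsSNC p q π) {u v x y b c : Fin (p + q)}
    (huv : u.val < v.val) (hv : v.val < p) (hy : y ∈ Set.Ioc u v) (hx : x ∉ Set.Ioc u v)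
    (h1 : π.SameCycle u v) (hui : ∀ m, π.SameCycle u m → m.val < p)
    (hxp : x.val < p) (hxb : π.SameCycle x b) (hb : p ≤ b.val) (hyc : π.SameCycle y c)
    (hc : p ≤ c.val) : False := by
  have hS : ∀ w : Fin (p + q), p ≤ w.val → w ∉ Set.Ioc u v := fun w hw h => by
    have := Fin.le_def.1 h.2
    omega
  have havoid : ∀ z w, π.SameCycle z w → p ≤ w.val → ∀ t, π.SameCycle u t →
      ¬ π.SameCycle z t := fun z w hzw hw t ht hzt =>
    absurd (hui w (ht.trans (hzt.symm.trans hzw))) (by omega)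
  have h2 : (π * Equiv.swap u v).SameCycle x b :=
    hxb.mul_swap (havoid x b hxb hb u (.refl _ _)) (havoid x b hxb hb v h1)
  have h3 : (π * Equiv.swap u v).SameCycle y c :=
    hyc.mul_swap (havoid y c hyc hc u (.refl _ _)) (havoid y c hyc hc v h1)
  have hγ := gammaPQ_mul_swap_mem_Ioc (q := q) huv hv
  have hxy : ¬ (gammaPQ p q * Equiv.swap u v).SameCycle x b := fun h => by
    have : b.val < p := h.mem_of_mapsTo (S := {z : Fin (p + q) | z.val < p})
      (fun z hz => gammaPQ_lt (x := Equiv.swap u v z)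
        (swap_apply_mem (S := {z : Fin (p + q) | z.val < p}) (iff_of_true (huv.trans hv) hv)
          hz)) hxp
    omega
  have hsplit : ∀ d, d ∉ Set.Ioc u v →
      ¬ (π * Equiv.swap u v * Equiv.swap x b).SameCycle y d := fun d hd h =>
    false_of_split_of_merge (numCycles_gammaPQ_le p q) hπ.2 (by rintro rfl; omega) h1 h2 h hxy
      fun h' => hd (h'.mem_of_mapsTo
        (fun z hz => hγ (Equiv.swap x b z) (swap_apply_mem (iff_of_false hx (hS b hb)) hz)) hy)
  refine hsplit c (hS c hc) (h3.mem_of_mapsTo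
    (S := {z | (π * Equiv.swap u v * Equiv.swap x b).SameCycle y z}) (fun z hz => ?_) (.refl _ _))
  have hzx : z ≠ x := by rintro rfl; exact hsplit _ hx hz
  have hzb : z ≠ b := by rintro rfl; exact hsplit _ (hS _ hb) hz
  have := Equiv.Perm.sameCycle_apply_right.2 hz
  rwa [Equiv.Perm.mul_apply, Equiv.swap_apply_of_ne_of_ne hzx hzb] at this

end

theorem stmt3 {p q : ℕ} (π : Equiv.Perm (Fin (p + q))) (hπ : IsSNC p q π)
    (i j k l : Fin (p + q))
    (h1 : i.val < j.val) (h2 : j.val < k.val) (h3 : k.val < l.val) (h4 : l.val < p)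
    (hik : barRel p q π i k) (hjl : barRel p q π j l) :
    barRel p q π i j := by
  rcases hik with ⟨hi, hik⟩ | ⟨hi, hk⟩ <;> rcases hjl with ⟨hj, hjl⟩ | ⟨hj, hl⟩
  · by_contra hn
    exact hπ.false_of_inner_of_inner (h1.trans h2) (h3.trans h4) (y := j) (x := l)
      ⟨h1, h2.le⟩ (fun h => absurd (Fin.le_def.1 h.2) (by omega)) hik hi hjl hj
      fun h => hn (.inl ⟨hi, h⟩)
  · push Not at hj hl
    obtain ⟨b, hlb, hb⟩ := hl
    obtain ⟨c, hjc, hc⟩ := hj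
    exact (hπ.false_of_inner_of_through (h1.trans h2) (h3.trans h4) (y := j) (x := l)
      ⟨h1, h2.le⟩ (fun h => absurd (Fin.le_def.1 h.2) (by omega)) hik hi h4 hlb hb hjc hc).elim
  · push Not at hi hk
    obtain ⟨b, hib, hb⟩ := hi
    obtain ⟨c, hkc, hc⟩ := hk
    exact (hπ.false_of_inner_of_through (h2.trans h3) h4 (y := k) (x := i)
      ⟨h2, h3.le⟩ (fun h => absurd (Fin.lt_def.1 h.1) (by omega)) hjl hj (by omega)
      hib hb hkc hc).elim
  · exact .inr ⟨hi, hj⟩
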